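/- Let V be a p-adic vertex algebra and let L(V) ⊆ End(V) be the p-adic closure of the linear span of all modes a(n) for a ∈ V, n ∈ ℤ. Then L(V) is closed under commutators [A,B] = AB - BA, hence is a Lie subalgebra of End(V). -/

import Mathlib

open Filter

variable {p : ℕ} [Fact p.Prime] {V : Type*} [NormedAddCommGroup V] [NormedSpace ℚ_[p] V]

/-- A `p`-adic field on a `p`-adic Banach space `V`, given by its modes
`A n : V →L[ℚ_[p]] V`: the modes are uniformly bounded, and `A n b → 0` as `n → ∞`
for every `b ∈ V`. -/
def IsPadicField (A : ℤ → V →L[ℚ_[p]] V) : Prop :=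
  (∃ M : ℝ, 0 ≤ M ∧ ∀ (n : ℤ) (b : V), ‖A n b‖ ≤ M * ‖b‖) ∧
    ∀ b : V, Tendsto (fun n : ℤ => A n b) atTop (nhds 0)

/-- A `p`-adic vertex algebra: a `p`-adic Banach space `V` with a continuous linear
state–field correspondence `Y` taking values in `p`-adic fields, a vacuum vector `𝟏`
of norm at most `1`, satisfying creativity and the `p`-adic Jacobi identity (whose
sums now converge `p`-adically rather than truncating). -/
structure PadicVertexAlgebra (p : ℕ) [Fact p.Prime] (V : Type*) [NormedAddCommGroup V]
    [NormedSpace ℚ_[p] V] [CompleteSpace V] [IsUltrametricDist V] where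
  /-- the state–field correspondence, recorded through its modes `Y a n = a(n)` -/
  Y : V →ₗ[ℚ_[p]] (ℤ → V →L[ℚ_[p]] V)
  /-- the vacuum vector `𝟏` -/
  one : V
  /-- each `Y(a,z)` is a `p`-adic field -/
  isField : ∀ a : V, IsPadicField (Y a)
  /-- `Y` is bounded (equivalently, continuous) for the sup-norm on fields -/
  Ybound : ∃ C : ℝ, 0 ≤ C ∧ ∀ (a : V) (n : ℤ), ‖Y a n‖ ≤ C * ‖a‖
  /-- vacuum normalization `|𝟏| ≤ 1` -/
  norm_one : ‖one‖ ≤ 1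
  /-- creativity: `a(-1)𝟏 = a` -/
  create_neg_one : ∀ a : V, Y a (-1) one = a
  /-- creativity: `a(n)𝟏 = 0` for `n ≥ 0` -/
  create_nonneg : ∀ a : V, ∀ n : ℤ, 0 ≤ n → Y a n one = 0
  /-- the `p`-adic Jacobi identity -/
  jacobi : ∀ u v w : V, ∀ r s t : ℤ,
    ∑' i : ℕ, Ring.choose r i • Y (Y u (t + i) v) (r + s - i) w =
    ∑' i : ℕ, ((-1) ^ i * Ring.choose t i : ℤ) •
      (Y u (r + t - i) (Y v (s + i) w)
        - (((-1 : ℤˣ) ^ t : ℤˣ) : ℤ) • Y v (s + t - i) (Y u (r + i) w))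

instance ContinuousLinearMap.instIsUltrametricDist [IsUltrametricDist V] :
    IsUltrametricDist (V →L[ℚ_[p]] V) :=
  IsUltrametricDist.isUltrametricDist_of_forall_norm_add_le_max_norm fun f g =>
    ContinuousLinearMap.opNorm_le_bound _ (le_max_of_le_left (norm_nonneg f)) fun x => by
      rw [_root_.add_apply, max_mul_of_nonneg _ _ (norm_nonneg x)]
      exact (IsUltrametricDist.norm_add_le_max _ _).trans
        (max_le_max (f.le_opNorm x) (g.le_opNorm x))

namespace PadicVertexAlgebra

variable [CompleteSpace V] [IsUltrametricDist V] (A : PadicVertexAlgebra p V)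

theorem summable_commutator_series (a b : V) (m n : ℤ) :
    Summable fun j : ℕ => Ring.choose m j • A.Y (A.Y a j b) (m + n - j) := by
  apply NonarchimedeanAddGroup.summable_of_tendsto_cofinite_zero
  rw [Nat.cofinite_eq_atTop]
  obtain ⟨C, -, hC⟩ := A.Ybound
  have h : Tendsto (fun j : ℕ => A.Y a j b) atTop (nhds 0) :=
    ((A.isField a).2 b).comp tendsto_natCast_atTop_atTop
  have h' : Tendsto (fun j : ℕ => C * ‖A.Y a j b‖) atTop (nhds 0) := by
    simpa using h.norm.const_mul C
  refine squeeze_zero_norm (fun j => ?_) h'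
  rw [← Int.cast_smul_eq_zsmul ℚ_[p], norm_smul]
  exact (mul_le_of_le_one_left (norm_nonneg _) (Padic.norm_int_le_one _)).trans (hC _ _)

/-- The commutator formula, with the series converging in operator norm. -/
theorem hasSum_commutator (a b : V) (m n : ℤ) :
    HasSum (fun j : ℕ => Ring.choose m j • A.Y (A.Y a j b) (m + n - j))
      ((A.Y a m).comp (A.Y b n) - (A.Y b n).comp (A.Y a m)) := by
  have hs := (A.summable_commutator_series a b m n).hasSum
  convert hs using 1
  ext w
  have hw := (hs.mapL (ContinuousLinearMap.apply ℚ_[p] V w)).tsum_eq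
  have hj := A.jacobi a b w m n 0
  rw [tsum_eq_single (f := fun i : ℕ => ((-1) ^ i * Ring.choose 0 i : ℤ) • _) 0 fun i hi => by
    rw [Ring.choose_zero_pos ℤ (Nat.pos_of_ne_zero hi), mul_zero, zero_smul]] at hj
  simp only [ContinuousLinearMap.apply_apply, _root_.smul_apply] at hw
  rw [← hw]
  simpa using hj.symm

/-- The linear span of the modes of a `p`-adic vertex algebra. -/
noncomputable def modeSpan : Submodule ℚ_[p] (V →L[ℚ_[p]] V) :=
  Submodule.span ℚ_[p] {T : V →L[ℚ_[p]] V | ∃ (a : V) (n : ℤ), T = A.Y a n}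

theorem commutator_modes_mem (a b : V) (m n : ℤ) :
    (A.Y a m).comp (A.Y b n) - (A.Y b n).comp (A.Y a m) ∈ A.modeSpan.topologicalClosure :=
  A.modeSpan.isClosed_topologicalClosure.mem_of_tendsto (A.hasSum_commutator a b m n)
    (Eventually.of_forall fun _ => sum_mem fun _ _ => zsmul_mem
      (A.modeSpan.le_topologicalClosure (Submodule.subset_span ⟨_, _, rfl⟩)) _)

theorem commutator_mem_of_mem_modeSpan {f g : V →L[ℚ_[p]] V}
    (hf : f ∈ A.modeSpan) (hg : g ∈ A.modeSpan) :
    f.comp g - g.comp f ∈ A.modeSpan.topologicalClosure := by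
  induction hf, hg using Submodule.span_induction₂ with
  | mem_mem x y hx hy =>
    obtain ⟨a, m, rfl⟩ := hx
    obtain ⟨b, n, rfl⟩ := hy
    exact A.commutator_modes_mem a b m n
  | zero_left y hy => simp
  | zero_right x hx => simp
  | add_left x y z _ _ _ h₁ h₂ =>
    convert add_mem h₁ h₂ using 1
    rw [ContinuousLinearMap.add_comp, ContinuousLinearMap.comp_add, add_sub_add_comm]
  | add_right x y z _ _ _ h₁ h₂ =>
    convert add_mem h₁ h₂ using 1
    rw [ContinuousLinearMap.add_comp, ContinuousLinearMap.comp_add, add_sub_add_comm]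
  | smul_left r x y _ _ h =>
    convert Submodule.smul_mem _ r h using 1
    rw [ContinuousLinearMap.smul_comp, ContinuousLinearMap.comp_smul, smul_sub]
  | smul_right r x y _ _ h =>
    convert Submodule.smul_mem _ r h using 1
    rw [ContinuousLinearMap.smul_comp, ContinuousLinearMap.comp_smul, smul_sub]

end PadicVertexAlgebra

/-- Let `L(V)` be the `p`-adic closure (in operator norm) of the linear span of all
modes `a(n)` of a `p`-adic vertex algebra. Then `L(V)` is closed under commutators,
hence is a Lie algebra. -/
theorem padicVertexAlgebra_closure_of_modes_is_lie_algebra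
    (p : ℕ) [Fact p.Prime] (V : Type*) [NormedAddCommGroup V] [NormedSpace ℚ_[p] V]
    [CompleteSpace V] [IsUltrametricDist V] (A : PadicVertexAlgebra p V) :
    ∀ f g : V →L[ℚ_[p]] V,
      f ∈ closure (Submodule.span ℚ_[p]
            {T : V →L[ℚ_[p]] V | ∃ (a : V) (n : ℤ), T = A.Y a n} : Set (V →L[ℚ_[p]] V)) →
      g ∈ closure (Submodule.span ℚ_[p]
            {T : V →L[ℚ_[p]] V | ∃ (a : V) (n : ℤ), T = A.Y a n} : Set (V →L[ℚ_[p]] V)) →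
      f.comp g - g.comp f ∈ closure (Submodule.span ℚ_[p]
            {T : V →L[ℚ_[p]] V | ∃ (a : V) (n : ℤ), T = A.Y a n} : Set (V →L[ℚ_[p]] V)) := by
  intro f g hf hg
  have hc : Continuous fun q : (V →L[ℚ_[p]] V) × (V →L[ℚ_[p]] V) =>
      q.1.comp q.2 - q.2.comp q.1 := by fun_prop
  have h := map_mem_closure₂ (f := fun f g : V →L[ℚ_[p]] V => f.comp g - g.comp f) hc hf hg
    fun _ hx _ hy => A.commutator_mem_of_mem_modeSpan hx hy
  rwa [A.modeSpan.isClosed_topologicalClosure.closure_eq] at h
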